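/- The series ∑_{n=1}^∞ n^{−3/2} (∑_{k=1}^∞ min(n,k)/k²)^{1/2} converges. -/

import Mathlib

lemma aux_summable (p : ℝ) (hp : p < -1) : Summable fun k : ℕ => ((k : ℝ) + 1) ^ p := by
  have h := (summable_nat_add_iff 1).2 (Real.summable_nat_rpow.2 hp)
  simpa using h

lemma aux_term (x y : ℝ) (hx : 0 < x) (hy : 0 < y) :
    min x y / y ^ 2 ≤ x ^ (1 / 2 : ℝ) * y ^ (-(3 : ℝ) / 2) := by
  have h1 : min x y ≤ x ^ (1 / 2 : ℝ) * y ^ (1 / 2 : ℝ) := by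
    rw [← Real.mul_rpow hx.le hy.le, ← Real.sqrt_eq_rpow]
    apply Real.le_sqrt_of_sq_le
    rw [sq]
    exact mul_le_mul (min_le_left _ _) (min_le_right _ _) (le_min hx.le hy.le) hx.le
  have h2 : y ^ (-(3 : ℝ) / 2) = y ^ (1 / 2 : ℝ) / y ^ 2 := by
    rw [← Real.rpow_natCast y 2, ← Real.rpow_sub hy]
    norm_num
  rw [h2, ← mul_div_assoc]
  gcongr

/-- The series `∑_{n=1}^∞ n^{-3/2} (∑_{k=1}^∞ min(n,k)/k²)^{1/2}` converges. -/
theorem stmt_14 :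
    Summable fun n : ℕ =>
      ((n : ℝ) + 1) ^ (-(3 : ℝ) / 2) *
        Real.sqrt (∑' k : ℕ, (min (n + 1) (k + 1) : ℝ) / ((k : ℝ) + 1) ^ 2) := by
  have hs := aux_summable (-(3 : ℝ) / 2) (by norm_num)
  set C := ∑' k : ℕ, ((k : ℝ) + 1) ^ (-(3 : ℝ) / 2) with hC
  refine Summable.of_nonneg_of_le (fun n => by positivity) (fun n => ?_)
    ((aux_summable (-(5 : ℝ) / 4) (by norm_num)).mul_right (Real.sqrt C))
  have hn : (0 : ℝ) < (n : ℝ) + 1 := by positivity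
  have hle : ∀ k : ℕ, (min (n + 1) (k + 1) : ℝ) / ((k : ℝ) + 1) ^ 2 ≤
      ((n : ℝ) + 1) ^ (1 / 2 : ℝ) * ((k : ℝ) + 1) ^ (-(3 : ℝ) / 2) :=
    fun k => aux_term _ _ hn (by positivity)
  have hs2 := hs.mul_left (((n : ℝ) + 1) ^ (1 / 2 : ℝ))
  have hs1 : Summable fun k : ℕ => (min (n + 1) (k + 1) : ℝ) / ((k : ℝ) + 1) ^ 2 :=
    Summable.of_nonneg_of_le (fun k => by positivity) hle hs2
  have h := hs1.tsum_le_tsum hle hs2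
  rw [tsum_mul_left, ← hC] at h
  have h4 : Real.sqrt (((n : ℝ) + 1) ^ (1 / 2 : ℝ)) = ((n : ℝ) + 1) ^ (1 / 4 : ℝ) := by
    rw [Real.sqrt_eq_rpow, ← Real.rpow_mul hn.le]
    norm_num
  have h5 : ((n : ℝ) + 1) ^ (-(5 : ℝ) / 4) =
      ((n : ℝ) + 1) ^ (-(3 : ℝ) / 2) * ((n : ℝ) + 1) ^ (1 / 4 : ℝ) := by
    rw [← Real.rpow_add hn]
    norm_num
  rw [h5, mul_assoc, ← h4, ← Real.sqrt_mul (by positivity)]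
  gcongr
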